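/- Let K be a field of characteristic 0, A a local Artinian K-algebra with maximal ideal m_A and residue field K, and (W, d) a cochain complex of K-vector spaces; extend d A-linearly to the complex (W ⊗_K A, d). Then: (1) the exponential g ↦ exp(g) is a bijection from { g ∈ End_A(W ⊗_K A) degree-preserving with g(W ⊗_K A) ⊆ W ⊗_K m_A and g∘d = d∘g } onto Aut_{W,d}(A) = { f : A-linear automorphism of W ⊗_K A, degree-preserving, (f − id)(W ⊗_K A) ⊆ W ⊗_K m_A, f∘d = d∘f }; (2) it restricts to a bijection from { g = d∘h + h∘d : h an A-linear map of degree −1 with h(W ⊗_K A) ⊆ W ⊗_K m_A } onto Aut⁰_{W,d}(A) = { f ∈ Aut_{W,d}(A) : H^n(f) is the identity on H^n(W ⊗_K A, d) for every n }. -/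

import Mathlib

universe u

/-- A cochain complex of `K`-vector spaces, given by its components and its
degree-one differential.  (The condition `d ∘ d = 0` is `Cx.IsComplex`.) -/
structure Cx (K : Type u) [Field K] where
  V : ℤ → Type u
  [acg : ∀ i, AddCommGroup (V i)]
  [mod : ∀ i, Module K (V i)]
  d : ∀ i, V i →ₗ[K] V (i + 1)

attribute [instance] Cx.acg Cx.mod

/-- The differential squares to zero. -/
def Cx.IsComplex {K : Type u} [Field K] (A : Cx K) : Prop :=
  ∀ (i : ℤ) (x : A.V i), A.d (i + 1) (A.d i x) = 0

open TensorProduct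

/-- The (truncated) exponential `exp(g) = Σ_{n<k} gⁿ/n!` of a family of
`A`-linear endomorphisms, taken degreewise; when each `(g i)ᵏ = 0` (as is the
case for every family considered below, `m_A` being nilpotent with
`m_Aᵏ = ⊥`) this is the full exponential `Σ_{n≥0} gⁿ/n!`. -/
noncomputable def expFam (K : Type u) [Field K] (A : Type u) [CommRing A]
    [Algebra K A] (k : ℕ) (W : Cx K)
    (g : ∀ i, (A ⊗[K] W.V i) →ₗ[A] (A ⊗[K] W.V i)) :
    ∀ i, (A ⊗[K] W.V i) →ₗ[A] (A ⊗[K] W.V i) := fun i =>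
  ∑ n ∈ Finset.range k, algebraMap K A ((n.factorial : K)⁻¹) • (g i) ^ n

namespace ExpBij
open Polynomial

lemma exists_left {R : Type*} [CommRing R] (r : R[X]) (j : ℕ) :
    ∃ q : R[X], X ^ (j+1) ∣ q.comp (X * (1 + X * r)) - X := by
  induction j with
  | zero => exact ⟨0, by simp⟩
  | succ j ih =>
    obtain ⟨q, t, ht⟩ := ih
    obtain ⟨r', hr'⟩ : X ∣ (1 + X * r) ^ (j+1) - 1 := by
      have := sub_dvd_pow_sub_pow (1 + X * r) 1 (j+1)
      rw [one_pow] at this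
      exact (Dvd.intro r (by ring)).trans this
    have h1 : (1 + X * r) ^ (j+1) = 1 + X * r' := by rw [← hr']; ring
    have h2 := X_mul_divX_add t
    refine ⟨q - C (t.coeff 0) * X ^ (j+1), t.divX - C (t.coeff 0) * r', ?_⟩
    have h3 : (q - C (t.coeff 0) * X ^ (j+1)).comp (X * (1 + X * r)) - X
      = (q.comp (X * (1 + X * r)) - X) - C (t.coeff 0) * (X ^ (j+1) * (1 + X * r) ^ (j+1)) := by
      simp [mul_pow]; ring
    rw [h3, ht, h1]
    nth_rewrite 1 [← h2]
    ring

lemma exists_right {R : Type*} [CommRing R] (r : R[X]) (j : ℕ) :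
    ∃ p : R[X], X ∣ p ∧ X ^ (j+1) ∣ (X * (1 + X * r)).comp p - X := by
  induction j with
  | zero => exact ⟨0, by simp⟩
  | succ j ih =>
    obtain ⟨p, ⟨p', hp⟩, t, ht⟩ := ih
    have h2 := X_mul_divX_add t
    set c := C (t.coeff 0) with hc
    set δ : R[X] := - (c * X ^ (j+1)) with hδ
    obtain ⟨z, hz⟩ := Polynomial.binomExpansion (r.map C) p δ
    have e : ∀ y : R[X], r.comp y = (r.map C).eval y := by
      intro y; rw [eval_map]; rfl
    refine ⟨p + δ, ⟨p' - c * X ^ j, by rw [hp, hδ]; ring⟩, ?_⟩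
    have h3 : (X * (1 + X * r)).comp (p + δ) - X
      = ((X * (1 + X * r)).comp p - X) + δ + (2 * p * δ + δ^2) * r.comp p
        + (p + δ)^2 * (δ * ((r.map C).derivative.eval p + z * δ)) := by
      simp only [mul_comp, add_comp, X_comp, one_comp, e, hz]; ring
    rw [h3, ht]
    have h4 : X ^ (j+1) * t + δ = X ^ (j+1+1) * t.divX := by
      nth_rewrite 1 [← h2]; rw [hδ]; ring
    have h5 : X ^ (j+1+1) ∣ p * δ := ⟨- p' * c, by rw [hp, hδ]; ring⟩
    have h6 : X ^ (j+1+1) ∣ δ ^ 2 := ⟨c ^ 2 * X ^ j, by rw [hδ]; ring⟩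
    have h7 : (2 * p * δ + δ^2) * r.comp p
        + (p + δ)^2 * (δ * ((r.map C).derivative.eval p + z * δ))
        = (p * δ) * (2 * r.comp p + (p + 2 * δ) * ((r.map C).derivative.eval p + z * δ))
         + δ ^ 2 * (r.comp p + δ * ((r.map C).derivative.eval p + z * δ)) := by ring
    rw [h4, add_assoc (X ^ (j+1+1) * t.divX), h7]
    exact dvd_add (dvd_mul_right _ _) (dvd_add (h5.mul_right _) (h6.mul_right _))

noncomputable def eP (K A : Type*) [Field K] [CommRing A] [Algebra K A] (k : ℕ) : A[X] :=
  ∑ n ∈ Finset.range k, C (algebraMap K A ((n.factorial : K)⁻¹)) * X ^ n - 1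

lemma eP_form (K A : Type*) [Field K] [CommRing A] [Algebra K A] (k : ℕ) :
    ∃ r : A[X], eP K A (k+2) = X * (1 + X * r) := by
  refine ⟨∑ n ∈ Finset.range k, C (algebraMap K A (((n+2).factorial : K)⁻¹)) * X ^ n, ?_⟩
  rw [eP, Finset.sum_range_succ', Finset.sum_range_succ', mul_add, ← mul_assoc, Finset.mul_sum]
  simp only [zero_add, Nat.factorial, Nat.cast_one, inv_one, map_one, pow_zero, mul_one, pow_one]
  have : ∀ a b : A[X], a = b → a + 1 * X + 1 - 1 = X + b := by rintro a b rfl; ring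
  apply this
  apply Finset.sum_congr rfl
  intros; ring

lemma eP_one (K A : Type*) [Field K] [CommRing A] [Algebra K A] : eP K A 1 = 0 := by
  simp [eP]

lemma eP_facts (K A : Type*) [Field K] [CommRing A] [Algebra K A] (k : ℕ) :
    X ∣ eP K A (k+1) ∧ (∃ q : A[X], X ^ (k+1) ∣ q.comp (eP K A (k+1)) - X) ∧
    ∃ p : A[X], X ∣ p ∧ X ^ (k+1) ∣ (eP K A (k+1)).comp p - X := by
  cases k with
  | zero => rw [zero_add, eP_one]; exact ⟨dvd_zero _, ⟨0, by simp⟩, ⟨0, by simp⟩⟩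
  | succ k =>
    obtain ⟨r, hr⟩ := eP_form K A k
    rw [show k + 1 + 1 = k + 2 from rfl, hr]
    exact ⟨dvd_mul_right _ _, exists_left r (k+1), exists_right r (k+1)⟩

section
variable {A : Type*} [CommRing A] {M N : Type*} [AddCommGroup M] [Module A M]
  [AddCommGroup N] [Module A N]

lemma smul_top_map (I : Ideal A) (f : M →ₗ[A] N) {x : M} (hx : x ∈ I • (⊤ : Submodule A M)) :
    f x ∈ I • (⊤ : Submodule A N) := by
  have := Submodule.mem_map_of_mem (f := f) hx
  rw [Submodule.map_smul''] at this
  exact Submodule.smul_mono le_rfl le_top this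

lemma pow_mem (I : Ideal A) (u : Module.End A M) (hu : ∀ x, u x ∈ I • (⊤ : Submodule A M))
    (n : ℕ) (x : M) : (u ^ n) x ∈ I ^ n • (⊤ : Submodule A M) := by
  induction n generalizing x with
  | zero => simp
  | succ n ih =>
    have h : (⊤ : Submodule A M).map (u ^ n) ≤ I ^ n • ⊤ := by
      rintro _ ⟨y, -, rfl⟩; exact ih y
    have := Submodule.mem_map_of_mem (f := u ^ n) (hu x)
    rw [Submodule.map_smul''] at this
    have h5 : I • (⊤ : Submodule A M).map (u ^ n) ≤ I ^ (n+1) • (⊤ : Submodule A M) := by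
      rw [pow_succ' I, Submodule.mul_smul]
      exact Submodule.smul_mono (le_refl I) h
    rw [pow_succ u]
    exact h5 this

lemma pow_zero' (I : Ideal A) (k : ℕ) (hk : I ^ k = ⊥) (u : Module.End A M)
    (hu : ∀ x, u x ∈ I • (⊤ : Submodule A M)) : u ^ k = 0 := by
  ext x
  have := pow_mem I u hu k x
  rw [hk] at this
  simpa using this

lemma aeval_mem (I : Ideal A) (u : Module.End A M)
    (hu : ∀ x, u x ∈ I • (⊤ : Submodule A M)) (p : A[X]) (hp : X ∣ p) (x : M) :
    aeval u p x ∈ I • (⊤ : Submodule A M) := by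
  obtain ⟨q, rfl⟩ := hp
  simpa using hu _

lemma aeval_comm (u : Module.End A M) (v : Module.End A N) (D : M →ₗ[A] N)
    (h : ∀ x, v (D x) = D (u x)) (p : A[X]) (x : M) : aeval v p (D x) = D (aeval u p x) := by
  induction p using Polynomial.induction_on' generalizing x with
  | add p q hp hq => simp [hp, hq]
  | monomial n a =>
    have : ∀ n x, (v ^ n) (D x) = D ((u ^ n) x) := by
      intro n
      induction n with
      | zero => simp
      | succ n ih => intro x; simp [pow_succ, h, ih]
    simp [aeval_monomial, this]

lemma aeval_of_dvd (u : Module.End A M) (k : ℕ) (hu : u ^ k = 0) (p : A[X])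
    (hp : X ^ k ∣ p - X) : aeval u p = u := by
  obtain ⟨t, ht⟩ := hp
  have : p = X ^ k * t + X := by rw [← ht]; ring
  rw [this]; simp [hu]

lemma bij (I : Ideal A) (k : ℕ) (hk : I ^ k = ⊥) (u : Module.End A M)
    (hu : ∀ x, u x ∈ I • (⊤ : Submodule A M)) : Function.Bijective ⇑(u + 1 : Module.End A M) := by
  rw [← Module.End.isUnit_iff]
  exact IsNilpotent.isUnit_add_one ⟨k, pow_zero' I k hk u hu⟩

lemma aeval_cyc {M' : Type*} [AddCommGroup M'] [Module A M'] (u : Module.End A M)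
    (v : Module.End A M') (D' : M' →ₗ[A] M) (h : ∀ x, u (D' x) = D' (v x))
    (p : A[X]) (hp : X ∣ p) (x : M) (hx : ∃ y, D' y = u x) : ∃ y, D' y = aeval u p x := by
  obtain ⟨q, rfl⟩ := hp
  obtain ⟨y, hy⟩ := hx
  refine ⟨aeval v q y, ?_⟩
  rw [mul_comm X q]
  simp [← hy, aeval_comm v u D' h]

end

lemma exists_ginv {K V V' : Type*} [Field K] [AddCommGroup V] [AddCommGroup V'] [Module K V]
    [Module K V'] (d : V →ₗ[K] V') : ∃ s : V' →ₗ[K] V, ∀ x, d (s (d x)) = d x := by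
  obtain ⟨s₀, hs₀⟩ := d.rangeRestrict.exists_rightInverse_of_surjective d.range_rangeRestrict
  obtain ⟨s, hs⟩ := LinearMap.exists_extend s₀
  refine ⟨s, fun x => ?_⟩
  have h1 : s (d x) = s₀ (d.rangeRestrict x) := by rw [← hs]; rfl
  rw [h1]
  have := LinearMap.congr_fun hs₀ (d.rangeRestrict x)
  exact congrArg Subtype.val this

open TensorProduct

lemma exists_ginv' {K V V' : Type*} [Field K] [AddCommGroup V] [AddCommGroup V'] [Module K V]
    [Module K V'] (A : Type*) [CommRing A] [Algebra K A] (d : V →ₗ[K] V') :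
    ∃ s : (A ⊗[K] V') →ₗ[A] (A ⊗[K] V),
      ∀ x, d.baseChange A (s (d.baseChange A x)) = d.baseChange A x := by
  obtain ⟨s, hs⟩ := exists_ginv d
  refine ⟨s.baseChange A, fun x => ?_⟩
  have : d ∘ₗ s ∘ₗ d = d := LinearMap.ext hs
  conv_rhs => rw [← this]
  simp [LinearMap.baseChange_comp]

lemma expFam_eq (K : Type u) [Field K] (A : Type u) [CommRing A]
    [Algebra K A] (k : ℕ) (W : Cx K)
    (g : ∀ i, (A ⊗[K] W.V i) →ₗ[A] (A ⊗[K] W.V i)) (i : ℤ) :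
    expFam K A k W g i = aeval (R := A) (A := Module.End A (A ⊗[K] W.V i)) (g i) (eP K A k) + 1 := by
  simp only [expFam, eP, map_sub, map_sum, map_mul, aeval_C, map_pow, aeval_X, map_one,
    sub_add_cancel]
  apply Finset.sum_congr rfl
  intro n _
  rw [Algebra.smul_def]

end ExpBij

/-- Let `K` be a field of characteristic 0, `A` a local Artinian `K`-algebra
with maximal ideal `m_A` (with `m_Aᵏ = ⊥`) and residue field `K`, and `(W, d)`
a cochain complex of `K`-vector spaces, extended `A`-linearly to `W ⊗ A`.
Then:
(1) the exponential `g ↦ exp(g)` is a bijection from the degree-preserving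
`A`-linear endomorphisms `g` of `W ⊗ A` with `g(W ⊗ A) ⊆ W ⊗ m_A` and
`g∘d = d∘g` onto `Aut_{W,d}(A)`, the set of degree-preserving `A`-linear
automorphisms `f` of `W ⊗ A` with `(f − id)(W ⊗ A) ⊆ W ⊗ m_A` and
`f∘d = d∘f`;
(2) it restricts to a bijection from `{ g = d∘h + h∘d }`, with `h` ranging
over the `A`-linear maps of degree `−1` with `h(W ⊗ A) ⊆ W ⊗ m_A`, onto
`Aut⁰_{W,d}(A)`, the set of those `f ∈ Aut_{W,d}(A)` inducing the identity on
the cohomology of `(W ⊗ A, d)` in every degree. -/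
theorem exp_bijection_complex (K : Type u) [Field K] [CharZero K]
    (A : Type u) [CommRing A] [Algebra K A] [IsLocalRing A] [IsArtinianRing A]
    (ε : A →ₐ[K] K) (hε : RingHom.ker (ε : A →+* K) = IsLocalRing.maximalIdeal A)
    (k : ℕ) (hk : (IsLocalRing.maximalIdeal A) ^ k = ⊥)
    (W : Cx K) (hW : W.IsComplex) :
    (Set.BijOn (expFam K A k W)
      { g : ∀ i, (A ⊗[K] W.V i) →ₗ[A] (A ⊗[K] W.V i) |
        (∀ i x, g i x ∈
          IsLocalRing.maximalIdeal A • (⊤ : Submodule A (A ⊗[K] W.V i))) ∧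
        ∀ (i : ℤ) (x : A ⊗[K] W.V i),
          g (i + 1) (LinearMap.baseChange A (W.d i) x) =
            LinearMap.baseChange A (W.d i) (g i x) }
      { f : ∀ i, (A ⊗[K] W.V i) →ₗ[A] (A ⊗[K] W.V i) |
        (∀ i, Function.Bijective (f i)) ∧
        (∀ i x, f i x - x ∈
          IsLocalRing.maximalIdeal A • (⊤ : Submodule A (A ⊗[K] W.V i))) ∧
        ∀ (i : ℤ) (x : A ⊗[K] W.V i),
          f (i + 1) (LinearMap.baseChange A (W.d i) x) =
            LinearMap.baseChange A (W.d i) (f i x) }) ∧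
    (Set.BijOn (expFam K A k W)
      { g : ∀ i, (A ⊗[K] W.V i) →ₗ[A] (A ⊗[K] W.V i) |
        ∃ h : ∀ i, (A ⊗[K] W.V (i + 1)) →ₗ[A] (A ⊗[K] W.V i),
          (∀ i x, h i x ∈
            IsLocalRing.maximalIdeal A • (⊤ : Submodule A (A ⊗[K] W.V i))) ∧
          ∀ i : ℤ, g (i + 1) =
            LinearMap.baseChange A (W.d i) ∘ₗ h i +
              h (i + 1) ∘ₗ LinearMap.baseChange A (W.d (i + 1)) }
      { f : ∀ i, (A ⊗[K] W.V i) →ₗ[A] (A ⊗[K] W.V i) |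
        ((∀ i, Function.Bijective (f i)) ∧
         (∀ i x, f i x - x ∈
           IsLocalRing.maximalIdeal A • (⊤ : Submodule A (A ⊗[K] W.V i))) ∧
         ∀ (i : ℤ) (x : A ⊗[K] W.V i),
           f (i + 1) (LinearMap.baseChange A (W.d i) x) =
             LinearMap.baseChange A (W.d i) (f i x)) ∧
        ∀ (i : ℤ) (x : A ⊗[K] W.V (i + 1)),
          LinearMap.baseChange A (W.d (i + 1)) x = 0 →
          ∃ y : A ⊗[K] W.V i,
            LinearMap.baseChange A (W.d i) y = f (i + 1) x - x }) := by
  obtain _ | k := k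
  · rw [pow_zero, Ideal.one_eq_top] at hk
    exact absurd hk top_ne_bot
  obtain ⟨heX, ⟨q, hq⟩, p, hpX, hp⟩ := ExpBij.eP_facts K A k
  set I := IsLocalRing.maximalIdeal A with hI
  have hDD : ∀ (i : ℤ) (x : A ⊗[K] W.V i), LinearMap.baseChange A (W.d (i+1))
      (LinearMap.baseChange A (W.d i) x) = 0 := by
    intro i x
    have : W.d (i+1) ∘ₗ W.d i = 0 := LinearMap.ext (hW i)
    have h2 := LinearMap.baseChange_comp (A := A) (W.d i) (W.d (i+1))
    rw [this, LinearMap.baseChange_zero] at h2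
    exact (LinearMap.congr_fun h2 x).symm
  -- forward map
  have hmaps : ∀ g : ∀ i, (A ⊗[K] W.V i) →ₗ[A] (A ⊗[K] W.V i),
      (∀ i x, g i x ∈ I • (⊤ : Submodule A (A ⊗[K] W.V i))) →
      (∀ (i : ℤ) (x : A ⊗[K] W.V i), g (i + 1) (LinearMap.baseChange A (W.d i) x) =
            LinearMap.baseChange A (W.d i) (g i x)) →
      ((∀ i, Function.Bijective (expFam K A (k+1) W g i)) ∧
        (∀ i x, expFam K A (k+1) W g i x - x ∈ I • (⊤ : Submodule A (A ⊗[K] W.V i))) ∧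
        ∀ (i : ℤ) (x : A ⊗[K] W.V i),
          expFam K A (k+1) W g (i + 1) (LinearMap.baseChange A (W.d i) x) =
            LinearMap.baseChange A (W.d i) (expFam K A (k+1) W g i x)) := by
    intro g hg hc
    simp only [ExpBij.expFam_eq]
    refine ⟨fun i => ExpBij.bij I (k+1) hk _ (ExpBij.aeval_mem I _ (hg i) _ heX), fun i x => ?_,
      fun i x => ?_⟩
    · simpa using ExpBij.aeval_mem I _ (hg i) _ heX x
    · simp [ExpBij.aeval_comm _ _ _ (hc i)]
  have hinj : ∀ g : ∀ i, (A ⊗[K] W.V i) →ₗ[A] (A ⊗[K] W.V i),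
      (∀ i x, g i x ∈ I • (⊤ : Submodule A (A ⊗[K] W.V i))) → ∀ i,
      Polynomial.aeval (R := A) (A := Module.End A (A ⊗[K] W.V i))
        (expFam K A (k+1) W g i - 1 : Module.End A (A ⊗[K] W.V i)) q = g i := by
    intro g hg i
    have h0 : (expFam K A (k+1) W g i - 1 : Module.End A (A ⊗[K] W.V i)) =
        Polynomial.aeval (R := A) (A := Module.End A (A ⊗[K] W.V i)) (g i) (ExpBij.eP K A (k+1)) := by
      rw [ExpBij.expFam_eq]
      exact add_sub_cancel_right (G := Module.End A (A ⊗[K] W.V i)) _ _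
    rw [h0, ← Polynomial.aeval_comp]
    exact ExpBij.aeval_of_dvd _ (k+1) (ExpBij.pow_zero' I _ hk _ (hg i)) _ hq
  -- logarithm
  have hlog : ∀ f : ∀ i, (A ⊗[K] W.V i) →ₗ[A] (A ⊗[K] W.V i),
      (∀ i x, f i x - x ∈ I • (⊤ : Submodule A (A ⊗[K] W.V i))) →
      (∀ (i : ℤ) (x : A ⊗[K] W.V i), f (i + 1) (LinearMap.baseChange A (W.d i) x) =
            LinearMap.baseChange A (W.d i) (f i x)) →
      ∃ g : ∀ i, (A ⊗[K] W.V i) →ₗ[A] (A ⊗[K] W.V i),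
        (∀ i x, g i x ∈ I • (⊤ : Submodule A (A ⊗[K] W.V i))) ∧
        (∀ (i : ℤ) (x : A ⊗[K] W.V i), g (i + 1) (LinearMap.baseChange A (W.d i) x) =
            LinearMap.baseChange A (W.d i) (g i x)) ∧
        expFam K A (k+1) W g = f ∧
        ∀ i x, (∃ y, LinearMap.baseChange A (W.d i) y = f (i+1) x - x) →
          ∃ y, LinearMap.baseChange A (W.d i) y = g (i+1) x := by
    intro f hf hc
    let u : ∀ i, Module.End A (A ⊗[K] W.V i) := fun i => f i - 1
    have hu : ∀ i x, u i x = f i x - x := fun i x => rfl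
    have huI : ∀ i x, u i x ∈ I • (⊤ : Submodule A (A ⊗[K] W.V i)) := hf
    have huc : ∀ (i : ℤ) (x : A ⊗[K] W.V i), u (i + 1) (LinearMap.baseChange A (W.d i) x) =
            LinearMap.baseChange A (W.d i) (u i x) := by
      intro i x; rw [hu, hu, hc, map_sub]
    refine ⟨fun i => Polynomial.aeval (u i) p, fun i => ExpBij.aeval_mem I _ (huI i) _ hpX,
      fun i => ExpBij.aeval_comm _ _ _ (huc i) p, ?_, ?_⟩
    · funext i
      rw [ExpBij.expFam_eq, ← Polynomial.aeval_comp,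
        ExpBij.aeval_of_dvd _ (k+1) (ExpBij.pow_zero' I _ hk _ (huI i)) _ hp]
      exact sub_add_cancel (f i) (1 : Module.End A (A ⊗[K] W.V i))
    · intro i x hx
      exact ExpBij.aeval_cyc (u (i+1)) (u i) _ (huc i) p hpX x hx
  -- null-homotopic maps
  have hnull : ∀ g : ∀ i, (A ⊗[K] W.V i) →ₗ[A] (A ⊗[K] W.V i),
      (∃ h : ∀ i, (A ⊗[K] W.V (i + 1)) →ₗ[A] (A ⊗[K] W.V i),
          (∀ i x, h i x ∈ I • (⊤ : Submodule A (A ⊗[K] W.V i))) ∧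
          ∀ i : ℤ, g (i + 1) =
            LinearMap.baseChange A (W.d i) ∘ₗ h i +
              h (i + 1) ∘ₗ LinearMap.baseChange A (W.d (i + 1))) →
      (∀ i x, g i x ∈ I • (⊤ : Submodule A (A ⊗[K] W.V i))) ∧
      (∀ (i : ℤ) (x : A ⊗[K] W.V i), g (i + 1) (LinearMap.baseChange A (W.d i) x) =
            LinearMap.baseChange A (W.d i) (g i x)) ∧
      ∀ i x, LinearMap.baseChange A (W.d (i + 1)) x = 0 →
          ∃ y, LinearMap.baseChange A (W.d i) y = g (i+1) x := by
    rintro g ⟨h, hh, hg⟩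
    refine ⟨?_, ?_, ?_⟩
    · intro i
      obtain ⟨j, rfl⟩ : ∃ j, i = j + 1 := ⟨i - 1, by ring⟩
      intro x
      rw [hg]
      exact add_mem (ExpBij.smul_top_map I (LinearMap.baseChange A (W.d j)) (hh _ _)) (hh _ _)
    · intro i
      obtain ⟨j, rfl⟩ : ∃ j, i = j + 1 := ⟨i - 1, by ring⟩
      intro x
      rw [hg, hg]
      simp [hDD]
    · intro i x hx
      exact ⟨h i x, by rw [hg]; simp [hx]⟩
  refine ⟨⟨?_, ?_, ?_⟩, ⟨?_, ?_, ?_⟩⟩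
  · rintro g ⟨hg, hc⟩
    exact hmaps g hg hc
  · rintro g ⟨hg, -⟩ g' ⟨hg', -⟩ he
    funext i
    rw [← hinj g hg i, ← hinj g' hg' i, he]
  · rintro f ⟨-, hf, hc⟩
    obtain ⟨g, h1, h2, h3, -⟩ := hlog f hf hc
    exact ⟨g, ⟨h1, h2⟩, h3⟩
  · intro g hg
    obtain ⟨h1, h2, h3⟩ := hnull g hg
    refine ⟨hmaps g h1 h2, fun i x hx => ?_⟩
    obtain ⟨y, hy⟩ := ExpBij.aeval_cyc (g (i+1)) (g i) _ (h2 i) _ heX x (h3 i x hx)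
    refine ⟨y, ?_⟩
    rw [hy, ExpBij.expFam_eq]
    simp
  · intro g hg g' hg' he
    funext i
    rw [← hinj g (hnull g hg).1 i, ← hinj g' (hnull g' hg').1 i, he]
  · rintro f ⟨⟨-, hf, hc⟩, hcyc⟩
    obtain ⟨g, h1, h2, h3, h4⟩ := hlog f hf hc
    refine ⟨g, ?_, h3⟩
    choose s hs using fun i => ExpBij.exists_ginv' A (W.d i)
    let D := fun i => LinearMap.baseChange A (W.d i)
    refine ⟨fun i => g i ∘ₗ s i + s i ∘ₗ g (i+1) ∘ₗ
      (LinearMap.id - D i ∘ₗ s i - s (i+1) ∘ₗ D (i+1)), ?_, ?_⟩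
    · intro i x
      exact add_mem (h1 _ _) (ExpBij.smul_top_map I (s i) (h1 _ _))
    · intro i
      ext1
      ext x
      set z : A ⊗[K] W.V (i+1) := 1 ⊗ₜ x
      change g (i+1) z = D i (g i (s i z) + s i (g (i+1) (z - D i (s i z) - s (i+1) (D (i+1) z))))
        + (g (i+1) (s (i+1) (D (i+1) z)) + s (i+1) (g (i+1+1) (D (i+1) z - D (i+1) (s (i+1) (D (i+1) z))
          - s (i+1+1) (D (i+1+1) (D (i+1) z)))))
      have e1 : D (i+1) (s (i+1) (D (i+1) z)) = D (i+1) z := hs (i+1) z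
      have e2 : D (i+1+1) (D (i+1) z) = 0 := hDD _ _
      have e3 : D (i+1) (D i (s i z)) = 0 := hDD _ _
      obtain ⟨y, hy⟩ : ∃ y, D i y = g (i+1) (z - D i (s i z) - s (i+1) (D (i+1) z)) := by
        have hz : D (i+1) (z - D i (s i z) - s (i+1) (D (i+1) z)) = 0 := by
          rw [map_sub, map_sub, e1, e3]; simp
        exact h4 i _ (hcyc i _ hz)
      have e4 : D i (s i (D i y)) = D i y := hs i y
      have e5 : D i (g i (s i z)) = g (i+1) (D i (s i z)) := (h2 i _).symm
      rw [← hy, map_add, e4, hy, e5, e1, e2]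
      simp only [map_sub, map_zero, sub_self]
      abel
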